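/- Let α be a positive integer with α ≤ max G, assume Ω_G(n) ≠ 0 for every integer n ≥ 0, and let κ_i^g (i = 0,…,m−1, g ∈ G) be admissible. Then for every n ≥ 0 the polynomials (q_n)_n satisfy ⟨q_n, q_i⟩_ξ = 0 for i = 0,…,n−1 and ⟨q_n, q_n⟩_ξ ≠ 0, where ⟨·,·⟩_ξ is the bilinear form defined below. -/

import Mathlib

open Polynomial Finset

/-- Pochhammer symbol `(a)_l = a (a+1) ⋯ (a+l-1)`, with `(a)_0 = 1`. -/
noncomputable def poch (a : ℝ) (l : ℕ) : ℝ := ∏ t ∈ Finset.range l, (a + t)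

/-- Generalized binomial coefficient `binom (n+α, n−j) = (α+j+1)⋯(α+n)/(n−j)!`. -/
noncomputable def genBinom (α : ℝ) (n j : ℕ) : ℝ :=
  (∏ t ∈ Finset.Ico (j + 1) (n + 1), (α + t)) / (Nat.factorial (n - j) : ℝ)

/-- Laguerre polynomial `L_n^α(x) = Σ_{j=0}^n ((−x)^j/j!)·binom(n+α, n−j)`. -/
noncomputable def laguerre (α : ℝ) (n : ℕ) : Polynomial ℝ :=
  ∑ j ∈ Finset.range (n + 1),
    Polynomial.C ((-1 : ℝ) ^ j / (Nat.factorial j : ℝ) * genBinom α n j) * Polynomial.X ^ j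

/-- Laguerre polynomials indexed by `ℤ`, with the convention `L_u^α = 0` for `u < 0`. -/
noncomputable def laguerreZ (α : ℝ) (n : ℤ) : Polynomial ℝ :=
  if n < 0 then 0 else laguerre α n.toNat

/-- The polynomial `binom (x+l, l) = (x+1)(x+2)⋯(x+l)/l!`. -/
noncomputable def binomPoly (l : ℕ) : Polynomial ℝ :=
  Polynomial.C ((Nat.factorial l : ℝ)⁻¹) *
    ∏ t ∈ Finset.range l, (Polynomial.X + Polynomial.C ((t : ℝ) + 1))

/-- The Casoratian `Ω_G(x) = det (R_{g_l}(x−j))_{l,j=1,…,m}`. -/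
noncomputable def casoratian {m : ℕ} (R : Fin m → Polynomial ℝ) (x : ℝ) : ℝ :=
  Matrix.det (Matrix.of fun l j : Fin m => (R l).eval (x - ((j : ℕ) + 1)))

/-- The maximum of the finite set `G` (given by the values of `g`). -/
noncomputable def Gmax {m : ℕ} (g : Fin m → ℕ) : ℕ := Finset.univ.sup g

/-- The polynomial `q_n`, defined as an `(m+1)×(m+1)` determinant whose first row is
`(L_n^α(x), …, L_{n−m}^α(x))` and whose `(h+1)`-th row is `(R_{g_h}(n), …, R_{g_h}(n−m))`. -/
noncomputable def qpoly (α : ℝ) {m : ℕ} (R : Fin m → Polynomial ℝ) (n : ℤ) : Polynomial ℝ :=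
  Matrix.det (Matrix.of fun i j : Fin (m + 1) =>
    if h : (i : ℕ) = 0 then laguerreZ α (n - (j : ℕ))
    else Polynomial.C ((R ⟨(i : ℕ) - 1, by have := i.isLt; omega⟩).eval ((n : ℝ) - ((j : ℕ) : ℝ))))

/-- `q_n` extended by the convention `q_k = 0` for `k < 0`. -/
noncomputable def qZ (α : ℝ) {m : ℕ} (R : Fin m → Polynomial ℝ) (n : ℤ) : Polynomial ℝ :=
  if n < 0 then 0 else qpoly α R n

/-- `momFun β p k = L_β(p(x)·x^k)`, where `L_β` is the moment functional on Laurent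
polynomials determined by `L_β(x^j) = Γ(β+j+1)`. -/
noncomputable def momFun (β : ℝ) (p : Polynomial ℝ) (k : ℤ) : ℝ :=
  ∑ t ∈ Finset.range (p.natDegree + 1), p.coeff t * Real.Gamma (β + t + k + 1)

/-- The bilinear form `⟨p, q⟩ = L_{α−m}(p·q) + Σ_{i=0}^{m−1} (q^{(i)}(0)/i!)·L_α(p·U_i)`,
where `U_i(x) = Σ_{g∈G} ( −x^{i−m}/m + κ_i^g·Σ_{l=0}^g (α−l)_l w_l^g x^{−l−1} )`. -/
noncomputable def bilin (α : ℝ) {m : ℕ} (g : Fin m → ℕ) (κ : ℕ → Fin m → ℝ)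
    (w : Fin m → ℕ → ℝ) (p q : Polynomial ℝ) : ℝ :=
  momFun (α - m) (p * q) 0 +
    ∑ i ∈ Finset.range m,
      (Polynomial.eval 0 (Polynomial.derivative^[i] q) / (Nat.factorial i : ℝ)) *
        (∑ h : Fin m,
          (-(1 / (m : ℝ)) * momFun α p ((i : ℤ) - (m : ℤ)) +
            κ i h * ∑ l ∈ Finset.range (g h + 1),
              poch (α - l) l * w h l * momFun α p (-((l : ℤ) + 1))))

/-- The bilinear form `⟨p, q⟩_ξ` (case `α` a positive integer with `α ≤ max G`). -/
noncomputable def bilinXi (α : ℕ) {m : ℕ} (g : Fin m → ℕ) (κ : ℕ → Fin m → ℝ)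
    (w : Fin m → ℕ → ℝ) (p q : Polynomial ℝ) : ℝ :=
  momFun ((α - m : ℕ) : ℝ) (p * Polynomial.derivative^[m - α] q) 0 +
    ∑ i ∈ Finset.range m,
      (Polynomial.eval 0 (Polynomial.derivative^[i] q) / (Nat.factorial i : ℝ)) *
        (∑ h : Fin m,
          (poch ((i : ℝ) - m + α + 1) (m - α) * (-(1 / (m : ℝ))) * momFun α p ((i : ℤ) - (m : ℤ)) +
            κ i h * ∑ l ∈ Finset.range (if g h < α then g h + 1 else α),
              poch ((α : ℝ) - l) l * w h l * momFun α p (-((l : ℤ) + 1)))) +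
    Real.Gamma α *
      ∑ i ∈ Finset.range m,
        (Polynomial.eval 0 (Polynomial.derivative^[i] q) / (Nat.factorial i : ℝ)) *
          ∑ h ∈ Finset.univ.filter (fun h : Fin m => α ≤ g h),
            κ i h *
              ∑ j ∈ Finset.range (g h - α + 1),
                (Polynomial.eval 0 (Polynomial.derivative^[j] p) / (Nat.factorial j : ℝ)) *
                  ∑ l ∈ Finset.Icc (α + j) (g h), poch ((α : ℝ) - l) j * w h l

theorem poch_succ (a : ℝ) (n : ℕ) : poch a (n+1) = poch a n * (a + n) := by
  simp [poch, Finset.prod_range_succ]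

theorem poch_succ' (a : ℝ) (n : ℕ) : poch a (n+1) = a * poch (a+1) n := by
  simp only [poch, Finset.prod_range_succ']
  rw [mul_comm]
  congr 1
  · simp
  · apply Finset.prod_congr rfl
    intro t _
    push_cast; ring

/-- Chu–Vandermonde. -/
theorem chu (n : ℕ) : ∀ a b : ℝ,
    ∑ t ∈ Finset.range (n+1), (n.choose t : ℝ) * (-1)^t * poch a t * poch (b+t) (n-t)
      = poch (b-a) n := by
  induction n with
  | zero => intro a b; simp [poch]
  | succ n ih =>
    intro a b
    rw [Finset.sum_range_succ']
    have h1 : ∑ t ∈ Finset.range (n+1), ((n+1).choose (t+1) : ℝ) * (-1)^(t+1) * poch a (t+1) *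
        poch (b+(t+1:ℕ)) (n+1-(t+1))
        = -a * ∑ t ∈ Finset.range (n+1), (n.choose t : ℝ) * (-1)^t * poch (a+1) t * poch ((b+1)+t) (n-t)
        + ∑ t ∈ Finset.range (n+1), (n.choose (t+1) : ℝ) * (-1)^(t+1) * poch a (t+1) *
        poch (b+(t+1:ℕ)) (n+1-(t+1)) := by
      rw [Finset.mul_sum, ← Finset.sum_add_distrib]
      apply Finset.sum_congr rfl
      intro t _
      have e : b + ((t+1:ℕ):ℝ) = b + 1 + t := by push_cast; ring
      have e2 : n + 1 - (t+1) = n - t := by omega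
      rw [Nat.choose_succ_succ, e, e2, poch_succ' a t]
      push_cast; ring
    have h2 : ∑ t ∈ Finset.range (n+1), (n.choose (t+1) : ℝ) * (-1)^(t+1) * poch a (t+1) *
        poch (b+(t+1:ℕ)) (n+1-(t+1)) + ((n+1).choose 0 : ℝ) * (-1)^0 * poch a 0 * poch (b+(0:ℕ)) (n+1-0)
        = (b+n) * ∑ t ∈ Finset.range (n+1), (n.choose t : ℝ) * (-1)^t * poch a t * poch (b+t) (n-t) := by
      have := (Finset.sum_range_succ' (fun t : ℕ => (n.choose t : ℝ) * (-1)^t * poch a t *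
        poch (b+(t:ℕ)) (n+1-t)) (n+1)).symm
      simp only [Nat.choose_zero_right] at this ⊢
      rw [this, Finset.sum_range_succ, Nat.choose_succ_self, Finset.mul_sum]
      simp only [Nat.cast_zero, zero_mul, add_zero]
      apply Finset.sum_congr rfl
      intro t ht
      have ht' : t ≤ n := by simpa [Nat.lt_succ_iff] using ht
      rw [show n + 1 - t = (n - t) + 1 by omega, poch_succ, Nat.cast_sub ht']
      ring
    rw [h1, add_assoc, h2, ih, ih, poch_succ]
    rw [show b + 1 - (a+1) = b - a by ring]
    ring

theorem genBinom_eq (α : ℝ) (n j : ℕ) (hj : j ≤ n) :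
    genBinom α n j = poch (α + 1 + j) (n - j) / ((n-j).factorial : ℝ) := by
  unfold genBinom poch
  congr 1
  rw [Finset.prod_Ico_eq_prod_range]
  rw [show n + 1 - (j+1) = n - j by omega]
  apply Finset.prod_congr rfl
  intro t _
  push_cast; ring

/-- The linear functional with moments `c`. -/
noncomputable def lin (c : ℕ → ℝ) : ℝ[X] →ₗ[ℝ] ℝ :=
  Polynomial.lsum (fun t => (LinearMap.mulRight ℝ (c t)))

theorem lin_eq_range (c : ℕ → ℝ) (p : ℝ[X]) :
    lin c p = ∑ t ∈ Finset.range (p.natDegree + 1), p.coeff t * c t := by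
  simp [lin, Polynomial.lsum_apply]
  rw [Polynomial.sum_over_range]
  intro n; simp

theorem lin_CX (c : ℕ → ℝ) (a : ℝ) (k : ℕ) : lin c (C a * X^k) = a * c k := by
  simp [lin, Polynomial.lsum_apply, Polynomial.C_mul_X_pow_eq_monomial, Polynomial.sum_monomial_index]

theorem lin_C_mul (c : ℕ → ℝ) (a : ℝ) (p : ℝ[X]) : lin c (C a * p) = a * lin c p := by
  rw [← Polynomial.smul_eq_C_mul, map_smul, smul_eq_mul]

theorem lin_mul_X_pow (c : ℕ → ℝ) (p : ℝ[X]) (k : ℕ) :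
    lin c (p * X^k) = lin (fun t => c (t + k)) p := by
  induction p using Polynomial.induction_on' with
  | add p q hp hq => rw [add_mul, map_add, map_add, hp, hq]
  | monomial n a =>
    rw [← Polynomial.C_mul_X_pow_eq_monomial, mul_assoc, ← pow_add, lin_CX, lin_CX]

theorem lin_mul_left (c : ℕ → ℝ) (a : ℝ) (p : ℝ[X]) : lin (fun t => a * c t) p = a * lin c p := by
  simp only [lin_eq_range, Finset.mul_sum]
  apply Finset.sum_congr rfl; intros; ring

theorem lin_sum {ι : Type*} (s : Finset ι) (c : ι → ℕ → ℝ) (p : ℝ[X]) :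
    lin (fun t => ∑ i ∈ s, c i t) p = ∑ i ∈ s, lin (c i) p := by
  simp only [lin_eq_range, Finset.mul_sum]
  rw [Finset.sum_comm]

theorem momFun_eq (β : ℝ) (p : ℝ[X]) (k : ℤ) :
    momFun β p k = lin (fun t => Real.Gamma (β + t + k + 1)) p := by
  rw [lin_eq_range]; rfl

theorem lin_laguerre (α : ℝ) (n : ℕ) (a : ℝ) :
    lin (poch a) (laguerre α n) = poch (α + 1 - a) n / (n.factorial : ℝ) := by
  unfold laguerre
  rw [map_sum, ← chu, Finset.sum_div]
  apply Finset.sum_congr rfl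
  intro t ht
  have ht' : t ≤ n := by simpa [Nat.lt_succ_iff] using ht
  rw [lin_CX, genBinom_eq _ _ _ ht', Nat.cast_choose ℝ ht']
  have := Nat.factorial_ne_zero n
  field_simp

theorem laguerre_coeff (α : ℝ) (n k : ℕ) :
    (laguerre α n).coeff k = if k ≤ n then (-1 : ℝ) ^ k / (Nat.factorial k : ℝ) * genBinom α n k else 0 := by
  unfold laguerre
  simp only [Polynomial.finsetSum_coeff, Polynomial.coeff_C_mul_X_pow]
  simp [Finset.sum_ite_eq, Nat.lt_succ_iff]

/-- Gamma moments. -/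
theorem gamma_poch (a : ℝ) (ha : 0 < a) (t : ℕ) :
    Real.Gamma (a + t) = Real.Gamma a * poch a t := by
  induction t with
  | zero => simp [poch]
  | succ t ih =>
    rw [poch_succ, ← mul_assoc, ← ih]
    push_cast
    rw [← add_assoc, Real.Gamma_add_one (by positivity)]
    ring

theorem poch_zero_of (k t : ℕ) (h : k < t) : poch (-(k:ℝ)) t = 0 := by
  unfold poch
  apply Finset.prod_eq_zero (Finset.mem_range.2 h)
  simp

theorem poch_desc (i d : ℕ) : poch ((i:ℝ) - d + 1) d = i.descFactorial d := by
  rcases le_or_gt d i with h | h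
  · obtain ⟨e, rfl⟩ := Nat.exists_eq_add_of_le h
    rw [Nat.add_comm d e, Nat.add_descFactorial_eq_ascFactorial, Nat.ascFactorial_eq_prod_range]
    unfold poch; push_cast
    apply Finset.prod_congr rfl; intros; ring
  · rw [Nat.descFactorial_eq_zero_iff_lt.2 h]
    have : ((i:ℝ) - d + 1) = -((d - i - 1 : ℕ) : ℝ) := by
      rw [Nat.sub_sub, Nat.cast_sub (by omega)]; push_cast; ring
    rw [this, poch_zero_of _ _ (by omega)]; simp

theorem gamma_moment_laguerre (α n k : ℕ) :
    lin (fun t => Real.Gamma ((α:ℝ) + t + k + 1)) (laguerre (α:ℝ) n) =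
      Real.Gamma ((α:ℝ) + k + 1) * (poch (-(k:ℝ)) n / (n.factorial : ℝ)) := by
  have : (fun t : ℕ => Real.Gamma ((α:ℝ) + t + k + 1)) =
      fun t => Real.Gamma ((α:ℝ) + k + 1) * poch ((α:ℝ) + k + 1) t := by
    funext t
    rw [← gamma_poch _ (by positivity)]
    congr 1; ring
  rw [this, lin_mul_left, lin_laguerre]
  congr 3; ring

theorem R_moment_laguerre (α n : ℕ) (G : ℕ) (w : ℕ → ℝ) (R : ℝ[X])
    (hw : R = ∑ l ∈ Finset.range (G + 1), Polynomial.C (w l) * binomPoly l) :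
    lin (fun t => ∑ l ∈ Finset.range (G+1), w l * poch ((α:ℝ) - l) t) (laguerre (α:ℝ) n)
      = R.eval (n:ℝ) := by
  rw [lin_sum, hw, Polynomial.eval_finsetSum]
  apply Finset.sum_congr rfl
  intro l _
  rw [lin_mul_left, lin_laguerre]
  simp only [binomPoly, eval_mul, eval_C, eval_prod, eval_add, eval_X]
  congr 1
  have h1 : poch ((α:ℝ) + 1 - (α - l)) n = ((n+l).factorial : ℝ) / l.factorial := by
    rw [show ((α:ℝ) + 1 - (α - l)) = ((n+l:ℕ):ℝ) - n + 1 by push_cast; ring, poch_desc]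
    rw [eq_div_iff (by positivity)]
    have := Nat.factorial_mul_descFactorial (show n ≤ n + l by omega)
    rw [Nat.add_sub_cancel_left] at this
    rw [mul_comm]; exact_mod_cast this
  have h2 : ∏ t ∈ Finset.range l, ((n:ℝ) + (t + 1)) = ((n+l).factorial : ℝ) / n.factorial := by
    have : ∏ t ∈ Finset.range l, ((n:ℝ) + (t + 1)) = poch (((n+l:ℕ):ℝ) - l + 1) l := by
      unfold poch; apply Finset.prod_congr rfl; intros; push_cast; ring
    rw [this, poch_desc, eq_div_iff (by positivity)]
    have := Nat.factorial_mul_descFactorial (show l ≤ n + l by omega)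
    rw [Nat.add_sub_cancel] at this
    rw [mul_comm]; exact_mod_cast this
  rw [h1, h2]
  ring

theorem coeff_eval (q : ℝ[X]) (i : ℕ) :
    Polynomial.eval 0 (Polynomial.derivative^[i] q) / (Nat.factorial i : ℝ) = q.coeff i := by
  rw [← Polynomial.coeff_zero_eq_eval_zero, Polynomial.coeff_iterate_derivative]
  simp [Nat.descFactorial_self]
  have := Nat.factorial_ne_zero i
  field_simp

theorem lin_congr_ext {c c' : ℕ → ℝ} (h : ∀ t, c t = c' t) (p : ℝ[X]) : lin c p = lin c' p := by
  rw [funext h]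

theorem main_term (α m : ℕ) (p q : ℝ[X]) (N : ℕ) (hN : q.natDegree < N) :
    momFun ((α - m : ℕ) : ℝ) (p * Polynomial.derivative^[m - α] q) 0 =
      ∑ i ∈ Finset.range N, q.coeff i * (poch ((i : ℝ) - m + α + 1) (m - α) *
        momFun α p ((i : ℤ) - (m : ℤ))) := by
  have hq : q = ∑ i ∈ Finset.range N, C (q.coeff i) * X ^ i :=
    Polynomial.as_sum_range_C_mul_X_pow' q hN
  conv_lhs => rw [hq]
  rw [momFun_eq, Polynomial.iterate_derivative_sum, Finset.mul_sum, map_sum]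
  apply Finset.sum_congr rfl
  intro i _
  rw [Polynomial.iterate_derivative_C_mul, Polynomial.iterate_derivative_X_pow_eq_natCast_mul,
    mul_left_comm, lin_C_mul]
  congr 1
  rw [show ((i.descFactorial (m-α) : ℕ) : ℝ[X]) = C (i.descFactorial (m-α) : ℝ) by simp,
    mul_left_comm, lin_C_mul, lin_mul_X_pow, momFun_eq]
  rcases le_total m α with h | h
  · have hd : m - α = 0 := by omega
    rw [hd]
    simp only [Nat.descFactorial_zero, poch, Finset.range_zero, Finset.prod_empty, Nat.cast_one]
    congr 1
    apply lin_congr_ext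
    intro t
    rw [Nat.cast_sub h]
    push_cast
    congr 1; simp; ring
  · have hp : poch ((i:ℝ) - m + α + 1) (m-α) = i.descFactorial (m-α) := by
      rw [← poch_desc, Nat.cast_sub h]; congr 1; ring
    rw [hp]
    rcases lt_or_ge i (m - α) with hi | hi
    · rw [Nat.descFactorial_eq_zero_iff_lt.2 hi]; simp
    · congr 1
      apply lin_congr_ext
      intro t
      rw [show α - m = 0 by omega]
      push_cast [Nat.cast_sub hi, Nat.cast_sub h]
      congr 1; ring

theorem second_term (α : ℕ) (hα : 0 < α) (G : ℕ) (w : ℕ → ℝ) (p : ℝ[X]) :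
    Real.Gamma α * lin (fun t => ∑ l ∈ Finset.range (G+1), w l * poch ((α:ℝ) - l) t) p =
      ∑ l ∈ Finset.range (if G < α then G + 1 else α),
              poch ((α : ℝ) - l) l * w l * momFun α p (-((l : ℤ) + 1)) +
      (if α ≤ G then Real.Gamma α * ∑ j ∈ Finset.range (G - α + 1),
                p.coeff j * ∑ l ∈ Finset.Icc (α + j) G, poch ((α : ℝ) - l) j * w l else 0) := by
  have key : ∀ l : ℕ, l < α → poch ((α : ℝ) - l) l * w l * momFun α p (-((l : ℤ) + 1)) =
      Real.Gamma α * (w l * lin (poch ((α:ℝ) - l)) p) := by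
    intro l hl
    have hpos : (0:ℝ) < (α:ℝ) - l := by
      have : (l:ℝ) < α := by exact_mod_cast hl
      linarith
    rw [momFun_eq]
    have e1 : lin (fun t : ℕ => Real.Gamma ((α:ℝ) + t + ((-((l : ℤ) + 1) : ℤ) : ℝ) + 1)) p =
      Real.Gamma ((α:ℝ) - l) * lin (poch ((α:ℝ) - l)) p := by
      rw [← lin_mul_left]
      apply lin_congr_ext
      intro t
      rw [← gamma_poch _ hpos]
      congr 1; push_cast; ring
    have e2 := gamma_poch ((α:ℝ) - l) hpos l
    rw [sub_add_cancel] at e2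
    rw [e1, e2]; ring
  rw [lin_sum]
  simp only [lin_mul_left]
  split_ifs with h1 h2 h2
  · omega
  · rw [add_zero, Finset.mul_sum]
    apply Finset.sum_congr rfl
    intro l hl
    rw [key l (by have := Finset.mem_range.1 hl; omega)]
  · obtain ⟨e, rfl⟩ := Nat.exists_eq_add_of_le h2
    rw [show α + e + 1 = α + (e + 1) by ring, Finset.sum_range_add, mul_add]
    congr 1
    · rw [Finset.mul_sum]
      apply Finset.sum_congr rfl
      intro l hl
      rw [key l (by have := Finset.mem_range.1 hl; omega)]
    · congr 1
      rw [show α + e - α + 1 = e + 1 by omega]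
      have h3 : ∀ l ∈ Finset.range (e+1), w (α + l) * lin (poch ((α:ℝ) - ((α + l : ℕ):ℝ))) p =
          ∑ j ∈ Finset.range (e+1), p.coeff j * (poch ((α:ℝ) - ((α + l : ℕ):ℝ)) j * w (α+l)) := by
        intro l hl
        have hl' := Finset.mem_range.1 hl
        have hz : ∀ j, l < j → poch ((α:ℝ) - ((α + l : ℕ):ℝ)) j = 0 := by
          intro j hj
          rw [← poch_zero_of l j hj]; congr 1; push_cast; ring
        rw [lin_eq_range, Finset.mul_sum]
        have t1 : ∀ j ∈ Finset.range (p.natDegree + 1 + (e + 1)), j ∉ Finset.range (p.natDegree + 1) →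
            w (α+l) * (p.coeff j * poch ((α:ℝ) - ((α + l : ℕ):ℝ)) j) = 0 := by
          intro j _ hj
          rw [Polynomial.coeff_eq_zero_of_natDegree_lt (by simpa using hj)]; ring
        have t2 : ∀ j ∈ Finset.range (p.natDegree + 1 + (e + 1)), j ∉ Finset.range (e + 1) →
            w (α+l) * (p.coeff j * poch ((α:ℝ) - ((α + l : ℕ):ℝ)) j) = 0 := by
          intro j _ hj
          rw [hz j (by simp at hj; omega)]; ring
        rw [Finset.sum_subset (by intro x hx; simp at hx ⊢; omega) t1,
          ← Finset.sum_subset (s₁ := Finset.range (e+1)) (by intro x hx; simp at hx ⊢; omega) t2]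
        apply Finset.sum_congr rfl; intros; ring
      rw [Finset.sum_congr rfl h3, Finset.sum_comm]
      apply Finset.sum_congr rfl
      intro j hj
      rw [← Finset.mul_sum]
      congr 1
      have hj' := Finset.mem_range.1 hj
      have : Finset.Icc (α + j) (α + e) = (Finset.Icc j e).map (addLeftEmbedding α) := by
        rw [Finset.map_add_left_Icc]
      rw [this, Finset.sum_map]
      symm
      apply Finset.sum_subset
      · intro x hx; simp at hx ⊢; omega
      · intro l hl hl2
        have : l < j := by simp at hl hl2; by_contra hh; have := hl2 (by omega); omega
        have : poch ((α:ℝ) - ((α + l : ℕ):ℝ)) j = 0 := by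
          rw [← poch_zero_of l j this]; congr 1; push_cast; ring
        simp only [addLeftEmbedding_apply]
        rw [this]; ring
  · omega

theorem bilinXi_eq (α : ℕ) (hα : 0 < α) {m : ℕ} (hm : 0 < m) (g : Fin m → ℕ) (κ : ℕ → Fin m → ℝ)
    (w : Fin m → ℕ → ℝ) (p q : ℝ[X]) (K : ℕ) (hK : q.natDegree < m + K) :
    bilinXi α g κ w p q =
      ∑ j ∈ Finset.range K, q.coeff (m + j) * (poch ((j:ℝ) + α + 1) (m - α) *
        lin (fun t => Real.Gamma ((α:ℝ) + t + j + 1)) p) +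
      Real.Gamma α * ∑ i ∈ Finset.range m, q.coeff i * ∑ h : Fin m, κ i h *
        lin (fun t => ∑ l ∈ Finset.range (g h+1), w h l * poch ((α:ℝ) - l) t) p := by
  unfold bilinXi
  simp only [coeff_eval]
  rw [main_term α m p q _ hK, Finset.sum_range_add]
  have e1 : ∑ j ∈ Finset.range K, q.coeff (m + j) * (poch (((m + j : ℕ):ℝ) - m + α + 1) (m - α) *
        momFun α p (((m + j : ℕ) : ℤ) - (m : ℤ))) =
      ∑ j ∈ Finset.range K, q.coeff (m + j) * (poch ((j:ℝ) + α + 1) (m - α) *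
        lin (fun t => Real.Gamma ((α:ℝ) + t + j + 1)) p) := by
    apply Finset.sum_congr rfl
    intro j _
    rw [momFun_eq]
    push_cast
    simp
  rw [e1]
  have e2 : Real.Gamma α * ∑ i ∈ Finset.range m, q.coeff i * ∑ h : Fin m, κ i h *
        lin (fun t => ∑ l ∈ Finset.range (g h+1), w h l * poch ((α:ℝ) - l) t) p =
      ∑ i ∈ Finset.range m, q.coeff i * ∑ h : Fin m, κ i h *
        (∑ l ∈ Finset.range (if g h < α then g h + 1 else α),
              poch ((α : ℝ) - l) l * w h l * momFun α p (-((l : ℤ) + 1))) +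
      Real.Gamma α *
      ∑ i ∈ Finset.range m,
        q.coeff i *
          ∑ h ∈ Finset.univ.filter (fun h : Fin m => α ≤ g h),
            κ i h *
              ∑ j ∈ Finset.range (g h - α + 1),
                p.coeff j *
                  ∑ l ∈ Finset.Icc (α + j) (g h), poch ((α : ℝ) - l) j * w h l := by
    rw [Finset.mul_sum, Finset.mul_sum, ← Finset.sum_add_distrib]
    apply Finset.sum_congr rfl
    intro i _
    rw [mul_left_comm, mul_left_comm (Real.Gamma _), ← mul_add]
    congr 1
    rw [Finset.sum_filter, Finset.mul_sum, Finset.mul_sum, ← Finset.sum_add_distrib]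
    apply Finset.sum_congr rfl
    intro h _
    rw [mul_left_comm, second_term α hα]
    split_ifs <;> ring
  rw [e2]
  have e3 : ∀ i : ℕ, ∑ h : Fin m,
          (poch ((i : ℝ) - m + α + 1) (m - α) * (-(1 / (m : ℝ))) * momFun α p ((i : ℤ) - (m : ℤ)) +
            κ i h * ∑ l ∈ Finset.range (if g h < α then g h + 1 else α),
              poch ((α : ℝ) - l) l * w h l * momFun α p (-((l : ℤ) + 1))) =
      - (poch ((i : ℝ) - m + α + 1) (m - α) * momFun α p ((i : ℤ) - (m : ℤ))) + 
      ∑ h : Fin m, κ i h *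
        (∑ l ∈ Finset.range (if g h < α then g h + 1 else α),
              poch ((α : ℝ) - l) l * w h l * momFun α p (-((l : ℤ) + 1))) := by
    intro i
    rw [Finset.sum_add_distrib]
    congr 1
    have : (m:ℝ) ≠ 0 := by positivity
    simp
    field_simp
  simp only [e3]
  simp only [mul_add, mul_neg, Finset.sum_add_distrib, Finset.sum_neg_distrib]
  ring

/-- The `j`-th minor. -/
noncomputable def dmin {m : ℕ} (R : Fin m → ℝ[X]) (n : ℕ) (j : Fin (m+1)) : ℝ :=
  Matrix.det (Matrix.of fun l k : Fin m => (R l).eval ((n:ℝ) - ((j.succAbove k : ℕ) : ℝ)))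

theorem dmin_zero {m : ℕ} (R : Fin m → ℝ[X]) (n : ℕ) : dmin R n 0 = casoratian R n := by
  unfold dmin casoratian
  simp

theorem dmin_last {m : ℕ} (R : Fin m → ℝ[X]) (n : ℕ) :
    dmin R n (Fin.last m) = casoratian R ((n + 1 : ℕ) : ℝ) := by
  unfold dmin casoratian
  congr 2
  funext l k
  simp

theorem qpoly_eq {m : ℕ} (α : ℝ) (R : Fin m → ℝ[X]) (n : ℕ) :
    qpoly α R (n:ℤ) = ∑ j : Fin (m+1), C ((-1)^(j:ℕ) * dmin R n j) * laguerreZ α ((n:ℤ) - (j:ℕ)) := by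
  unfold qpoly
  rw [Matrix.det_succ_row_zero]
  apply Finset.sum_congr rfl
  intro j _
  have : (Matrix.submatrix (Matrix.of fun i j : Fin (m + 1) =>
    if h : (i : ℕ) = 0 then laguerreZ α ((n:ℤ) - (j : ℕ))
    else Polynomial.C ((R ⟨(i : ℕ) - 1, by have := i.isLt; omega⟩).eval (((n:ℤ) : ℝ) - ((j : ℕ) : ℝ))))
      Fin.succ j.succAbove) = 
      (C : ℝ →+* ℝ[X]).mapMatrix (Matrix.of fun l k : Fin m => (R l).eval ((n:ℝ) - ((j.succAbove k : ℕ) : ℝ))) := by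
    ext1 l k
    simp
  rw [this, ← RingHom.map_det]
  simp [dmin]
  ring

theorem dmin_sum {m : ℕ} (R : Fin m → ℝ[X]) (n : ℕ) (h : Fin m) :
    ∑ j : Fin (m+1), (-1)^(j:ℕ) * dmin R n j * (R h).eval ((n:ℝ) - (j:ℕ)) = 0 := by
  have h0 : Matrix.det (Matrix.of (Fin.cons (fun j : Fin (m+1) => (R h).eval ((n:ℝ) - (j:ℕ)))
      (fun l : Fin m => fun j : Fin (m+1) => (R l).eval ((n:ℝ) - (j:ℕ))) :
        Fin (m+1) → Fin (m+1) → ℝ)) = 0 := by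
    apply Matrix.det_zero_of_row_eq (i := 0) (j := h.succ) (Fin.succ_ne_zero h).symm
    funext j; simp
  rw [Matrix.det_succ_row_zero] at h0
  rw [← h0]
  apply Finset.sum_congr rfl
  intro j _
  rw [mul_right_comm]
  congr 1

theorem lin_q {m : ℕ} (α : ℝ) (R : Fin m → ℝ[X]) (n : ℕ) (c : ℕ → ℝ) :
    lin c (qpoly α R (n:ℤ)) = ∑ j : Fin (m+1), ((-1)^(j:ℕ) * dmin R n j) *
      (if n < (j:ℕ) then 0 else lin c (laguerre α (n - j))) := by
  rw [qpoly_eq, map_sum]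
  apply Finset.sum_congr rfl
  intro j _
  rw [lin_C_mul]
  congr 1
  unfold laguerreZ
  by_cases h : n < (j:ℕ)
  · rw [if_pos h, if_pos (by omega), map_zero]
  · rw [if_neg h, if_neg (by omega)]
    congr 2; omega

theorem coeff_q {m : ℕ} (α : ℝ) (R : Fin m → ℝ[X]) (n k : ℕ) (hk : n ≤ k) :
    (qpoly α R (n:ℤ)).coeff k = if k = n then casoratian R n * ((-1)^n / n.factorial) else 0 := by
  rw [qpoly_eq, Polynomial.finsetSum_coeff, Fin.sum_univ_succ, Finset.sum_eq_zero, add_zero]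
  · rw [Polynomial.coeff_C_mul, dmin_zero]
    simp only [laguerreZ]
    rw [if_neg (by simp)]
    simp only [Fin.val_zero, Nat.cast_zero, sub_zero, Int.toNat_natCast, laguerre_coeff]
    by_cases h : k = n
    · subst h; simp [genBinom]
    · rw [if_neg h, if_neg (by omega), mul_zero]
  · intro j _
    rw [Polynomial.coeff_C_mul]
    unfold laguerreZ
    split_ifs with h
    · simp
    · rw [laguerre_coeff, if_neg, mul_zero]
      simp at h ⊢
      omega

theorem natDegree_q {m : ℕ} (α : ℝ) (R : Fin m → ℝ[X]) (n : ℕ) :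
    (qpoly α R (n:ℤ)).natDegree ≤ n := by
  rw [Polynomial.natDegree_le_iff_coeff_eq_zero]
  intro k hk
  rw [coeff_q _ _ _ _ hk.le, if_neg (by omega)]

/-- Gamma moments of `q_n`. -/
theorem mom_q_zero {m : ℕ} (α : ℕ) (R : Fin m → ℝ[X]) (n k : ℕ) (hk : m + k < n) :
    lin (fun t => Real.Gamma ((α:ℝ) + t + k + 1)) (qpoly (α:ℝ) R (n:ℤ)) = 0 := by
  rw [lin_q]
  apply Finset.sum_eq_zero
  intro j _
  have := j.isLt
  rw [if_neg (by omega), gamma_moment_laguerre, poch_zero_of _ _ (by omega)]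
  simp

theorem mom_q_ne {m : ℕ} (α : ℕ) (R : Fin m → ℝ[X]) (k : ℕ) (hc : casoratian R ((m + k + 1 : ℕ):ℝ) ≠ 0) :
    lin (fun t => Real.Gamma ((α:ℝ) + t + k + 1)) (qpoly (α:ℝ) R ((m + k : ℕ):ℤ)) ≠ 0 := by
  rw [lin_q, Fin.sum_univ_castSucc, Finset.sum_eq_zero, zero_add, dmin_last]
  · simp only [Fin.val_last]
    rw [if_neg (by omega), gamma_moment_laguerre, Nat.add_sub_cancel_left]
    refine mul_ne_zero (mul_ne_zero (by simp) hc) (mul_ne_zero (Real.Gamma_pos_of_pos (by positivity)).ne' (div_ne_zero ?_ (by positivity)))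
    unfold poch
    rw [Finset.prod_ne_zero_iff]
    intro t ht
    have : (t:ℝ) < k := by exact_mod_cast Finset.mem_range.1 ht
    intro h; linarith
  · intro j _
    have := j.isLt
    simp only [Fin.val_castSucc]
    rw [if_neg (by omega), gamma_moment_laguerre, poch_zero_of _ _ (by omega)]
    simp

/-- The `κ`-part of the form. -/
theorem kap_q {m : ℕ} (α : ℕ) (R : Fin m → ℝ[X]) (g : Fin m → ℕ) (w : Fin m → ℕ → ℝ)
    (hw : ∀ h : Fin m, R h = ∑ l ∈ Finset.range (g h + 1), Polynomial.C (w h l) * binomPoly l)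
    (κ : Fin m → ℝ) (n : ℕ) :
    ∑ h : Fin m, κ h * lin (fun t => ∑ l ∈ Finset.range (g h+1), w h l * poch ((α:ℝ) - l) t)
        (qpoly (α:ℝ) R (n:ℤ)) =
      - ∑ j : Fin (m+1), ((-1)^(j:ℕ) * dmin R n j) *
        (if n < (j:ℕ) then ∑ h : Fin m, κ h * (R h).eval ((n:ℝ) - (j:ℕ)) else 0) := by
  have e : ∀ h : Fin m, lin (fun t => ∑ l ∈ Finset.range (g h+1), w h l * poch ((α:ℝ) - l) t)
        (qpoly (α:ℝ) R (n:ℤ)) = - ∑ j : Fin (m+1), ((-1)^(j:ℕ) * dmin R n j) *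
        (if n < (j:ℕ) then (R h).eval ((n:ℝ) - (j:ℕ)) else 0) := by
    intro h
    rw [lin_q, eq_neg_iff_add_eq_zero, ← Finset.sum_add_distrib]
    refine Eq.trans ?_ (dmin_sum R n h)
    apply Finset.sum_congr rfl
    intro j _
    split_ifs with hj
    · ring
    · rw [R_moment_laguerre α (n - j) (g h) (w h) (R h) (hw h), Nat.cast_sub (by omega)]
      ring
  simp only [e, mul_neg, Finset.sum_neg_distrib, Finset.mul_sum]
  rw [Finset.sum_comm]
  congr 1
  apply Finset.sum_congr rfl
  intro j _
  split_ifs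
  · rw [Finset.mul_sum]; apply Finset.sum_congr rfl; intros; ring
  · simp

/-- for a positive integer `α ≤ max G` and admissible `κ_i^g`, the polynomials
`(q_n)_n` satisfy `⟨q_n, q_i⟩_ξ = 0` for `i = 0,…,n−1` and `⟨q_n, q_n⟩_ξ ≠ 0`. -/
theorem statement8 (α : ℕ) (hα : 0 < α) (m : ℕ) (hm : 0 < m) (g : Fin m → ℕ)
    (hg : StrictMono g) (hgpos : ∀ i, 0 < g i) (hαG : α ≤ Gmax g)
    (R : Fin m → Polynomial ℝ)
    (hdeg : ∀ i, (R i).natDegree = g i)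
    (hlead : ∀ i, (R i).leadingCoeff = 1 / (Nat.factorial (g i) : ℝ))
    (hΩ : ∀ n : ℕ, casoratian R (n : ℝ) ≠ 0)
    (w : Fin m → ℕ → ℝ)
    (hw : ∀ h : Fin m, R h = ∑ l ∈ Finset.range (g h + 1), Polynomial.C (w h l) * binomPoly l)
    (κ : ℕ → Fin m → ℝ)
    (hκ : ∀ i : ℕ, i < m →
      (∀ j : ℕ, 1 ≤ j → j + i + 1 ≤ m → ∑ h : Fin m, κ i h * (R h).eval (-(j : ℝ)) = 0) ∧
        ∑ h : Fin m, κ i h * (R h).eval (-(m : ℝ) + (i : ℝ)) ≠ 0) :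
    ∀ n : ℕ,
      (∀ i : ℕ, i < n →
        bilinXi α g κ w (qpoly (α : ℝ) R (n : ℤ)) (qpoly (α : ℝ) R (i : ℤ)) = 0) ∧
        bilinXi α g κ w (qpoly (α : ℝ) R (n : ℤ)) (qpoly (α : ℝ) R (n : ℤ)) ≠ 0 := by
  
  have kap0 : ∀ n i : ℕ, i < m → i < n → ∑ h : Fin m, κ i h *
      lin (fun t => ∑ l ∈ Finset.range (g h+1), w h l * poch ((α:ℝ) - l) t)
        (qpoly (α:ℝ) R (n:ℤ)) = 0 := by
    intro n i him hin
    rw [kap_q α R g w hw (κ i) n, neg_eq_zero]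
    apply Finset.sum_eq_zero
    intro j _
    split_ifs with hj
    · have := (hκ i him).1 (j - n) (by omega) (by have := j.isLt; omega)
      rw [Nat.cast_sub hj.le, neg_sub] at this
      rw [this, mul_zero]
    · simp
  have kap1 : ∀ n : ℕ, n < m → ∑ h : Fin m, κ n h *
      lin (fun t => ∑ l ∈ Finset.range (g h+1), w h l * poch ((α:ℝ) - l) t)
        (qpoly (α:ℝ) R (n:ℤ)) ≠ 0 := by
    intro n hn
    rw [kap_q α R g w hw (κ n) n, neg_ne_zero, Fin.sum_univ_castSucc, Finset.sum_eq_zero, zero_add,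
      dmin_last]
    · simp only [Fin.val_last]
      rw [if_pos hn]
      refine mul_ne_zero (mul_ne_zero (by simp) (hΩ _)) ?_
      have := (hκ n hn).2
      rwa [neg_add_eq_sub] at this
    · intro j _
      simp only [Fin.val_castSucc]
      split_ifs with hj
      · have := (hκ n hn).1 (j - n) (by omega) (by have := j.isLt; omega)
        rw [Nat.cast_sub hj.le, neg_sub] at this
        rw [this, mul_zero]
      · simp
  have hqn : ∀ n : ℕ, (qpoly (α:ℝ) R (n:ℤ)).coeff n ≠ 0 := by
    intro n
    rw [coeff_q _ _ _ _ le_rfl, if_pos rfl]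
    exact mul_ne_zero (hΩ n) (div_ne_zero (by simp) (by positivity))
  have hG : Real.Gamma (α:ℝ) ≠ 0 := (Real.Gamma_pos_of_pos (by exact_mod_cast hα)).ne'
  have hz : ∀ i k : ℕ, i < k → (qpoly (α:ℝ) R (i:ℤ)).coeff k = 0 := by
    intro i k hik
    exact Polynomial.coeff_eq_zero_of_natDegree_lt (lt_of_le_of_lt (natDegree_q _ _ _) hik)
  intro n
  constructor
  · intro i hi
    rw [bilinXi_eq α hα hm g κ w _ _ (i+1) (by have := natDegree_q (α:ℝ) R i; omega)]
    rw [Finset.sum_eq_zero, Finset.sum_eq_zero, mul_zero, add_zero]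
    · intro k hk
      rcases lt_or_ge k n with h | h
      · rw [kap0 n k (Finset.mem_range.1 hk) h, mul_zero]
      · rw [hz i k (by omega), zero_mul]
    · intro j _
      rcases lt_or_ge (m + j) n with h | h
      · rw [mom_q_zero α R n j h]; simp
      · rw [hz i (m+j) (by omega), zero_mul]
  · rw [bilinXi_eq α hα hm g κ w _ _ (n+1) (by have := natDegree_q (α:ℝ) R n; omega)]
    rcases lt_or_ge n m with hnm | hnm
    · rw [Finset.sum_eq_zero, zero_add]
      · refine mul_ne_zero hG ?_
        rw [Finset.sum_eq_single n]
        · exact mul_ne_zero (hqn n) (kap1 n hnm)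
        · intro k hk hkn
          rcases lt_or_ge k n with h | h
          · rw [kap0 n k (Finset.mem_range.1 hk) h, mul_zero]
          · rw [hz n k (by omega), zero_mul]
        · intro h; exact absurd (Finset.mem_range.2 hnm) h
      · intro j _
        rw [hz n (m+j) (by omega), zero_mul]
    · obtain ⟨k, rfl⟩ := Nat.exists_eq_add_of_le hnm
      have hs : ∑ i ∈ Finset.range m, (qpoly (α:ℝ) R ((m + k : ℕ):ℤ)).coeff i * ∑ h : Fin m, κ i h *
        lin (fun t => ∑ l ∈ Finset.range (g h+1), w h l * poch ((α:ℝ) - l) t)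
          (qpoly (α:ℝ) R ((m + k : ℕ):ℤ)) = 0 := by
        apply Finset.sum_eq_zero
        intro i hi
        have := Finset.mem_range.1 hi
        rw [kap0 _ i this (by omega), mul_zero]
      rw [hs, mul_zero, add_zero, Finset.sum_eq_single k]
      · refine mul_ne_zero (hqn _) (mul_ne_zero ?_ (mom_q_ne α R k (hΩ _)))
        unfold poch
        exact Finset.prod_ne_zero_iff.2 (fun t _ => by positivity)
      · intro j _ hj
        rcases lt_or_ge j k with h | h
        · rw [mom_q_zero α R (m+k) j (by omega)]; simp
        · rw [hz (m+k) (m+j) (by omega), zero_mul]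
      · intro h; simp at h
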